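/- arXiv:math/0701436 — 4 statements merged into one kernel-verified Lean document; each statement's English description precedes it below -/
import Mathlib

section
/- Let (a_n) and (b_n) be real sequences with b_n > 0 for all n ∈ ℕ. If the sequence (a_n/b_n) is strictly increasing, then for every n ≥ 1 the sum T_n = ∑_{k=0}^{n} (n−k)(a_{n−k} b_k − a_k b_{n−k}) is strictly positive; if (a_n/b_n) is strictly decreasing, then T_n is strictly negative for every n ≥ 1. -/
/-- Averaging the weighted sum of cross differences with its reflection `k ↦ n - k`. -/
theorem two_mul_sum_cross_diff (a b : ℕ → ℝ) (n : ℕ) :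
    2 * ∑ k ∈ Finset.range (n + 1),
      ((n : ℝ) - (k : ℝ)) * (a (n - k) * b k - a k * b (n - k)) =
    ∑ k ∈ Finset.range (n + 1),
      ((n : ℝ) - 2 * (k : ℝ)) * (a (n - k) * b k - a k * b (n - k)) := by
  rw [two_mul]
  nth_rewrite 1 [← Finset.sum_flip]
  rw [← Finset.sum_add_distrib]
  refine Finset.sum_congr rfl fun k hk => ?_
  have hkn : k ≤ n := Nat.lt_succ_iff.mp (Finset.mem_range.mp hk)
  rw [Nat.sub_sub_self hkn, Nat.cast_sub hkn]
  ring

theorem cross_diff_pos {a b : ℕ → ℝ} (hb : ∀ n, 0 < b n)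
    (h : StrictMono (fun n => a n / b n)) {i j : ℕ} (hij : i < j) :
    0 < a j * b i - a i * b j :=
  sub_pos.mpr ((div_lt_div_iff₀ (hb i) (hb j)).mp (h hij))

theorem sum_cross_diff_pos {a b : ℕ → ℝ} (hb : ∀ n, 0 < b n)
    (h : StrictMono (fun n => a n / b n)) {n : ℕ} (hn : 1 ≤ n) :
    0 < ∑ k ∈ Finset.range (n + 1),
      ((n : ℝ) - (k : ℝ)) * (a (n - k) * b k - a k * b (n - k)) := by
  refine pos_of_mul_pos_right (a := 2) ?_ zero_le_two
  rw [two_mul_sum_cross_diff]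
  refine Finset.sum_pos' (fun k hk => ?_) ⟨0, by simp, ?_⟩
  · have hkn : k ≤ n := Nat.lt_succ_iff.mp (Finset.mem_range.mp hk)
    have hcast : (n : ℝ) - 2 * k = ((n - k : ℕ) : ℝ) - k := by
      rw [Nat.cast_sub hkn]
      ring
    rw [hcast]
    rcases lt_trichotomy k (n - k) with hlt | heq | hgt
    · exact mul_nonneg (sub_nonneg.mpr (by exact_mod_cast hlt.le))
        (cross_diff_pos hb h hlt).le
    · rw [← heq]
      simp
    · refine mul_nonneg_of_nonpos_of_nonpos (sub_nonpos.mpr (by exact_mod_cast hgt.le)) ?_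
      linarith [cross_diff_pos hb h hgt]
  · have hn' : (0 : ℝ) < n := by exact_mod_cast hn
    simpa using mul_pos hn' (cross_diff_pos hb h (Nat.lt_of_lt_of_le one_pos hn))

theorem stmt0 (a b : ℕ → ℝ) (hb : ∀ n, 0 < b n) (T : ℕ → ℝ)
    (hT : ∀ n, T n = ∑ k ∈ Finset.range (n + 1),
      ((n : ℝ) - (k : ℝ)) * (a (n - k) * b k - a k * b (n - k))) :
    (StrictMono (fun n => a n / b n) → ∀ n, 1 ≤ n → 0 < T n) ∧
    (StrictAnti (fun n => a n / b n) → ∀ n, 1 ≤ n → T n < 0) := by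
  refine ⟨fun h n hn => hT n ▸ sum_cross_diff_pos hb h hn, fun h n hn => ?_⟩
  have hneg : StrictMono (fun n => (-a) n / b n) := fun i j hij => by
    simpa [neg_div] using h hij
  rw [hT, ← neg_pos, ← Finset.sum_neg_distrib]
  refine (sum_cross_diff_pos hb hneg hn).trans_eq (Finset.sum_congr rfl fun k _ => ?_)
  simp only [Pi.neg_apply]
  ring
end

section
/- Let ∑_{n=0}^{∞} a_n x^n and ∑_{n=0}^{∞} b_n x^n be two real power series converging on the interval (−R, R), with b_n > 0 for all n. If the sequence (a_n/b_n) is strictly increasing, then the function f(x) = (∑_{n=0}^{∞} a_n x^n)/(∑_{n=0}^{∞} b_n x^n) is strictly increasing on (0, R); if (a_n/b_n) is strictly decreasing, then f is strictly decreasing on (0, R). -/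
/-- Cross-multiplied form of the monotonicity of a ratio of two power series: the values at
`x < y` compare strictly when the ratios of the coefficients increase strictly. -/
theorem tsum_mul_tsum_lt_of_strictMono_div {a b : ℕ → ℝ} {x y : ℝ} (hb : ∀ n, 0 < b n)
    (hmono : StrictMono fun n => a n / b n) (hx : 0 < x) (hxy : x < y)
    (hax : Summable fun n => a n * x ^ n) (hay : Summable fun n => a n * y ^ n)
    (hbx : Summable fun n => b n * x ^ n) (hby : Summable fun n => b n * y ^ n) :
    (∑' n, a n * x ^ n) * (∑' n, b n * y ^ n) < (∑' n, a n * y ^ n) * (∑' n, b n * x ^ n) := by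
  have hy : 0 < y := hx.trans hxy
  have hBx : 0 < ∑' n, b n * x ^ n :=
    hbx.tsum_pos (fun n => by have := hb n; positivity) 0 (by simpa using hb 0)
  have hlt : ∑' n, b n * x ^ n < ∑' n, b n * y ^ n :=
    Summable.tsum_lt_tsum (i := 1)
      (fun n => mul_le_mul_of_nonneg_left (pow_le_pow_left₀ hx.le hxy.le n) (hb n).le)
      (by simpa using mul_lt_mul_of_pos_left hxy (hb 1)) hbx hby
  have key := (((hay.hasSum.mul_right (∑' n, b n * x ^ n)).sub
    (hax.hasSum.mul_right (∑' n, b n * y ^ n))))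
  have keyb := (((hby.hasSum.mul_right (∑' n, b n * x ^ n)).sub
    (hbx.hasSum.mul_right (∑' n, b n * y ^ n))))
  set Ax := ∑' n, a n * x ^ n
  set Ay := ∑' n, a n * y ^ n
  set Bx := ∑' n, b n * x ^ n
  set By := ∑' n, b n * y ^ n
  have hex : ∃ n, By * x ^ n ≤ Bx * y ^ n := by
    obtain ⟨n, hn⟩ := pow_unbounded_of_one_lt (By / Bx) ((one_lt_div hx).2 hxy)
    refine ⟨n, ?_⟩
    rw [div_pow, div_lt_div_iff₀ hBx (by positivity)] at hn
    linarith
  obtain ⟨N, hN, hmin⟩ : ∃ N, By * x ^ N ≤ Bx * y ^ N ∧ ∀ n < N, Bx * y ^ n < By * x ^ n :=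
    ⟨Nat.find hex, Nat.find_spec hex, fun n hn => not_le.1 (Nat.find_min hex hn)⟩
  have hge : ∀ n, N ≤ n → By * x ^ n ≤ Bx * y ^ n := by
    intro n hn
    induction n, hn using Nat.le_induction with
    | base => exact hN
    | succ n _ ih =>
      calc By * x ^ (n + 1) = By * x ^ n * x := by ring
        _ ≤ Bx * y ^ n * y := by gcongr
        _ = Bx * y ^ (n + 1) := by ring
  have hN0 : 0 < N := by
    rcases Nat.eq_zero_or_pos N with h | h
    · subst h
      simp only [pow_zero, mul_one] at hN
      linarith
    · exact h
  have hsum := key.sub (keyb.mul_left (a N / b N))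
  have hterm : ∀ n, a n * y ^ n * Bx - a n * x ^ n * By
      - a N / b N * (b n * y ^ n * Bx - b n * x ^ n * By)
      = b n * ((a n / b n - a N / b N) * (Bx * y ^ n - By * x ^ n)) := by
    intro n
    have := (hb n).ne'
    have := (hb N).ne'
    field_simp
  simp only [hterm] at hsum
  have hpos := hsum.summable.tsum_pos (fun n => by
    refine mul_nonneg (hb n).le ?_
    rcases lt_or_ge n N with h | h
    · exact mul_nonneg_of_nonpos_of_nonpos (sub_nonpos.2 (hmono h).le)
        (sub_nonpos.2 (hmin n h).le)
    · exact mul_nonneg (sub_nonneg.2 (hmono.monotone h)) (sub_nonneg.2 (hge n h))) 0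
    (mul_pos (hb 0) (mul_pos_of_neg_of_neg (sub_neg.2 (hmono hN0)) (sub_neg.2 (hmin 0 hN0))))
  rw [hsum.tsum_eq, mul_comm By Bx, sub_self, mul_zero, sub_zero] at hpos
  exact sub_pos.1 hpos

/-- A ratio of two power series on `(-R, R)`, with positive coefficients in the denominator, is
strictly increasing on `(0, R)` when the ratios of the coefficients increase strictly. -/
theorem strictMonoOn_tsum_div_tsum {R : ℝ} {a b : ℕ → ℝ} (hb : ∀ n, 0 < b n)
    (hca : ∀ x ∈ Set.Ioo (-R) R, Summable fun n => a n * x ^ n)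
    (hcb : ∀ x ∈ Set.Ioo (-R) R, Summable fun n => b n * x ^ n)
    (hmono : StrictMono fun n => a n / b n) :
    StrictMonoOn (fun x : ℝ => (∑' n, a n * x ^ n) / (∑' n, b n * x ^ n)) (Set.Ioo 0 R) := by
  have hmem : ∀ x ∈ Set.Ioo 0 R, x ∈ Set.Ioo (-R) R := fun x hx =>
    ⟨by linarith [hx.1, hx.2], hx.2⟩
  have hpos : ∀ x ∈ Set.Ioo 0 R, 0 < ∑' n, b n * x ^ n := fun x hx =>
    (hcb x (hmem x hx)).tsum_pos (fun n => (mul_pos (hb n) (pow_pos hx.1 n)).le) 0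
      (by simpa using hb 0)
  intro x hx y hy hxy
  exact (div_lt_div_iff₀ (hpos x hx) (hpos y hy)).2
    (tsum_mul_tsum_lt_of_strictMono_div hb hmono hx.1 hxy (hca x (hmem x hx)) (hca y (hmem y hy))
      (hcb x (hmem x hx)) (hcb y (hmem y hy)))

theorem stmt1 (R : ℝ) (hR : 0 < R) (a b : ℕ → ℝ) (hb : ∀ n, 0 < b n)
    (hca : ∀ x ∈ Set.Ioo (-R) R, Summable fun n => a n * x ^ n)
    (hcb : ∀ x ∈ Set.Ioo (-R) R, Summable fun n => b n * x ^ n) :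
    (StrictMono (fun n => a n / b n) →
      StrictMonoOn (fun x : ℝ => (∑' n, a n * x ^ n) / (∑' n, b n * x ^ n)) (Set.Ioo 0 R)) ∧
    (StrictAnti (fun n => a n / b n) →
      StrictAntiOn (fun x : ℝ => (∑' n, a n * x ^ n) / (∑' n, b n * x ^ n)) (Set.Ioo 0 R)) := by
  refine ⟨strictMonoOn_tsum_div_tsum hb hca hcb, fun hanti x hx y hy hxy => ?_⟩
  have h := strictMonoOn_tsum_div_tsum (a := fun n => -a n) hb
    (fun x hx => by simpa only [neg_mul] using (hca x hx).neg) hcb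
    (fun m n hmn => by simpa only [neg_div, neg_lt_neg_iff] using hanti hmn) hx hy hxy
  simpa only [neg_mul, tsum_neg, neg_div, neg_lt_neg_iff] using h
end

section
/- Let 0 < a, b < c, and define on [0, ∞): f(x) = F(a,b;c;1−e^{−x}), g(x) = f(x)·e^{−(a+b−c)x}, and h(x) = f'(x)·e^{−(a+b−c)x}. Then f, g, and h are increasing on [0,∞), with f(0) = g(0) = 1 and h(0) = ab/c. Moreover: if a+b > c then f(x) → ∞ as x → ∞; if a+b = c then f(x) → ∞ and g(x) → ∞ as x → ∞; if a+b < c then f(x) → B(c, c−a−b)/B(c−a, c−b) and g(x) → ∞ as x → ∞. Finally, h(x) → Γ(c)Γ(a+b+1−c)/(Γ(a)Γ(b)) as x → ∞ if a+b+1 > c, and h(x) → ∞ if a+b+1 ≤ c. -/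
open Filter Set

/-- Shifted factorial (Appell symbol) `(a,n) = a(a+1)⋯(a+n−1)`, with `(a,0)=1`. -/
noncomputable def shiftedFact (a : ℝ) (n : ℕ) : ℝ := ∏ i ∈ Finset.range n, (a + i)

/-- Gaussian hypergeometric function `F(a,b;c;x)` as a real power series. -/
noncomputable def hypF (a b c x : ℝ) : ℝ :=
  ∑' n : ℕ, (shiftedFact a n * shiftedFact b n / (shiftedFact c n * (n.factorial : ℝ))) * x ^ n

/-- Beta function `B(x,y) = Γ(x)Γ(y)/Γ(x+y)`. -/
noncomputable def betaR (x y : ℝ) : ℝ := Real.Gamma x * Real.Gamma y / Real.Gamma (x + y)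

theorem shiftedFact_zero (a : ℝ) : shiftedFact a 0 = 1 := by simp [shiftedFact]

theorem shiftedFact_succ (a : ℝ) (n : ℕ) :
    shiftedFact a (n + 1) = shiftedFact a n * (a + n) := by
  simp [shiftedFact, Finset.prod_range_succ]

theorem shiftedFact_succ_left (a : ℝ) (n : ℕ) :
    shiftedFact a (n + 1) = a * shiftedFact (a + 1) n := by
  simp only [shiftedFact, Finset.prod_range_succ', Nat.cast_zero, add_zero, Nat.cast_add,
    Nat.cast_one, mul_comm a]
  simp only [add_assoc, add_comm (1 : ℝ)]

theorem shiftedFact_pos {a : ℝ} (ha : 0 < a) (n : ℕ) : 0 < shiftedFact a n :=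
  Finset.prod_pos fun i _ => by positivity

theorem Gamma_add_natCast {a : ℝ} (ha : 0 < a) (n : ℕ) :
    Real.Gamma (a + n) = shiftedFact a n * Real.Gamma a := by
  induction n with
  | zero => simp [shiftedFact_zero]
  | succ n ih =>
    rw [Nat.cast_succ, ← add_assoc, Real.Gamma_add_one (by positivity), ih, shiftedFact_succ]
    ring

theorem shiftedFact_eq_eval_ascPochhammer (a : ℝ) (n : ℕ) :
    shiftedFact a n = (ascPochhammer ℝ n).eval a := by
  induction n with
  | zero => simp [shiftedFact_zero]
  | succ n ih => rw [shiftedFact_succ, ascPochhammer_succ_eval, ih]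

/-- The Taylor coefficients of `hypF a b c`. -/
noncomputable def hypCoeff (a b c : ℝ) (n : ℕ) : ℝ :=
  shiftedFact a n * shiftedFact b n / (shiftedFact c n * (n.factorial : ℝ))

theorem hypF_eq_tsum (a b c x : ℝ) : hypF a b c x = ∑' n, hypCoeff a b c n * x ^ n := rfl

theorem hypCoeff_zero (a b c : ℝ) : hypCoeff a b c 0 = 1 := by
  simp [hypCoeff, shiftedFact_zero]

theorem hypCoeff_pos {a b c : ℝ} (ha : 0 < a) (hb : 0 < b) (hc : 0 < c) (n : ℕ) :
    0 < hypCoeff a b c n := by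
  have := shiftedFact_pos ha n
  have := shiftedFact_pos hb n
  have := shiftedFact_pos hc n
  unfold hypCoeff
  positivity

theorem hypCoeff_succ_mul {a b c : ℝ} (hc : 0 < c) (n : ℕ) :
    hypCoeff a b c (n + 1) * ((c + n) * (n + 1)) = hypCoeff a b c n * ((a + n) * (b + n)) := by
  have := shiftedFact_pos hc n
  simp only [hypCoeff, shiftedFact_succ, Nat.factorial_succ, Nat.cast_mul, Nat.cast_succ]
  field_simp

theorem succ_mul_hypCoeff_succ {a b c : ℝ} (hc : 0 < c) (n : ℕ) :
    (n + 1) * hypCoeff a b c (n + 1) = a * b / c * hypCoeff (a + 1) (b + 1) (c + 1) n := by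
  have := shiftedFact_pos (add_pos hc one_pos) n
  simp only [hypCoeff, shiftedFact_succ_left, Nat.factorial_succ, Nat.cast_mul, Nat.cast_succ]
  field_simp

theorem hasSum_shiftedFact_div_factorial_mul_pow (a : ℝ) {x : ℝ} (hx : |x| < 1) :
    HasSum (fun n : ℕ => shiftedFact a n / n.factorial * x ^ n) ((1 - x) ^ (-a)) := by
  have h := (Real.one_div_one_sub_rpow_hasFPowerSeriesOnBall_zero a).hasSum (y := x)
    (by simpa [enorm_eq_nnnorm, ← NNReal.coe_lt_one] using hx)
  have h1 : 0 < 1 - x := by linarith [(abs_lt.mp hx).2]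
  rw [zero_add, one_div, ← Real.rpow_neg h1.le] at h
  convert! h using 2 with n
  rw [FormalMultilinearSeries.ofScalars_apply_eq, Ring.choose, smul_eq_mul]
  have := Ring.factorial_nsmul_multichoose_eq_ascPochhammer a n
  rw [Polynomial.ascPochhammer_smeval_eq_eval, nsmul_eq_mul,
    ← shiftedFact_eq_eval_ascPochhammer] at this
  rw [← this, show a + n - 1 - n + 1 = a by ring]
  field_simp

theorem summable_hypCoeff_mul_pow {a b c : ℝ} (ha : 0 < a) (hb : 0 < b) (hac : a < c) {x : ℝ}
    (hx : |x| < 1) : Summable fun n => hypCoeff a b c n * x ^ n := by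
  have hc := ha.trans hac
  refine Summable.of_norm_bounded
    (hasSum_shiftedFact_div_factorial_mul_pow b (x := |x|) (by simpa using hx)).summable fun n => ?_
  have h1 := shiftedFact_pos ha n
  have h2 := shiftedFact_pos hb n
  have h3 := shiftedFact_pos hc n
  have h4 : shiftedFact a n ≤ shiftedFact c n :=
    Finset.prod_le_prod (fun i _ => by positivity) fun i _ => by linarith
  rw [norm_mul, norm_pow, Real.norm_eq_abs, Real.norm_eq_abs,
    abs_of_pos (hypCoeff_pos ha hb hc n), hypCoeff]
  gcongr ?_ * _
  rw [div_le_div_iff₀ (by positivity) (by positivity)]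
  nlinarith [mul_le_mul_of_nonneg_right h4
    (show 0 ≤ shiftedFact b n * (n.factorial : ℝ) by positivity)]

theorem hypF_zero (a b c : ℝ) : hypF a b c 0 = 1 := by
  rw [hypF_eq_tsum, tsum_eq_single 0 fun n hn => by simp [hn]]
  simp [hypCoeff_zero]

theorem hypF_monotoneOn {a b c : ℝ} (ha : 0 < a) (hb : 0 < b) (hac : a < c) :
    MonotoneOn (hypF a b c) (Ico 0 1) := by
  intro x hx y hy hxy
  refine Summable.tsum_le_tsum (fun n => ?_)
    (summable_hypCoeff_mul_pow ha hb hac (by rw [abs_of_nonneg hx.1]; exact hx.2))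
    (summable_hypCoeff_mul_pow ha hb hac (by rw [abs_of_nonneg hy.1]; exact hy.2))
  have hx0 := hx.1
  exact mul_le_mul_of_nonneg_left (by gcongr) (hypCoeff_pos ha hb (ha.trans hac) n).le

theorem hasDerivAt_hypF {a b c : ℝ} (ha : 0 < a) (hb : 0 < b) (hac : a < c) {x : ℝ}
    (hx : |x| < 1) :
    HasDerivAt (hypF a b c) (a * b / c * hypF (a + 1) (b + 1) (c + 1) x) x := by
  have hc := ha.trans hac
  obtain ⟨r, hxr, hr⟩ := exists_between hx
  have hr0 : 0 < r := (abs_nonneg x).trans_lt hxr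
  have hsum : ∀ y : ℝ, |y| < 1 → Summable fun n : ℕ => n * hypCoeff a b c n * y ^ (n - 1) := by
    intro y hy
    rw [← summable_nat_add_iff 1]
    convert! (summable_hypCoeff_mul_pow (add_pos ha one_pos) (add_pos hb one_pos)
      (add_lt_add_left hac 1) hy).mul_left (a * b / c) using 2 with n
    rw [← mul_assoc, ← succ_mul_hypCoeff_succ hc]
    simp
  have key := hasDerivAt_tsum_of_isPreconnected (t := Ioo (-r) r) (y₀ := x) (y := x)
    (g := fun n y => hypCoeff a b c n * y ^ n)
    (g' := fun n y => n * hypCoeff a b c n * y ^ (n - 1))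
    (hsum r (by rwa [abs_of_pos hr0])) isOpen_Ioo isPreconnected_Ioo
    (fun n y _ => ((hasDerivAt_pow n y).const_mul (hypCoeff a b c n)).congr_deriv (by ring))
    (fun n y hy => by
      have := hypCoeff_pos ha hb hc n
      have hy' := (abs_lt.mpr hy).le
      rw [norm_mul, norm_pow, Real.norm_eq_abs, Real.norm_eq_abs, abs_of_nonneg (by positivity)]
      gcongr)
    (abs_lt.mp hxr) (summable_hypCoeff_mul_pow ha hb hac hx) (abs_lt.mp hxr)
  convert! key using 1
  rw [(hsum x hx).tsum_eq_zero_add, hypF_eq_tsum, ← tsum_mul_left]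
  simp only [CharP.cast_eq_zero, zero_mul, zero_add]
  refine tsum_congr fun n => ?_
  rw [← mul_assoc, ← succ_mul_hypCoeff_succ hc]
  simp

theorem tendsto_hypF_of_summable {a b c : ℝ} (ha : 0 < a) (hb : 0 < b) (hc : 0 < c)
    (h : Summable (hypCoeff a b c)) :
    Tendsto (hypF a b c) (nhdsWithin 1 (Iio 1)) (nhds (∑' n, hypCoeff a b c n)) := by
  have hcont : ContinuousOn (hypF a b c) (Icc 0 1) := by
    refine continuousOn_tsum (fun n => by fun_prop) h fun n x hx => ?_
    have := hypCoeff_pos ha hb hc n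
    have := hx.1
    change ‖hypCoeff a b c n * x ^ n‖ ≤ _
    rw [Real.norm_of_nonneg (by positivity)]
    exact mul_le_of_le_one_right (by positivity) (pow_le_one₀ hx.1 hx.2)
  have h1 := (hcont 1 (by simp)).mono_of_mem_nhdsWithin
    (mem_of_superset (Ioo_mem_nhdsLT one_pos) Ioo_subset_Icc_self)
  simpa [ContinuousWithinAt, hypF_eq_tsum] using h1

theorem not_summable_hypCoeff {a b c : ℝ} (ha : 0 < a) (hb : 0 < b) (hc : 0 < c)
    (h : c ≤ a + b) : ¬ Summable (hypCoeff a b c) := by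
  obtain ⟨k, hk, hk1, hk2⟩ : ∃ k : ℝ, 0 < k ∧ k ≤ a * b ∧ k * c ≤ a * b :=
    ⟨min (a * b) (a * b / c), by positivity, min_le_left _ _,
      (le_div_iff₀ hc).mp (min_le_right _ _)⟩
  have key : ∀ n : ℕ, k ≤ hypCoeff a b c n * (n + k) := by
    intro n
    induction n with
    | zero => simp [hypCoeff_zero]
    | succ n ih =>
      refine ih.trans ?_
      have hA := hypCoeff_pos ha hb hc n
      have hrec := hypCoeff_succ_mul (a := a) (b := b) hc n
      have hd : 0 < (c + n) * ((n : ℝ) + 1) := by positivity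
      have hn : (0 : ℝ) ≤ n := n.cast_nonneg
      refine le_of_mul_le_mul_right ?_ hd
      have h2 : (n + k) * ((c + n) * ((n : ℝ) + 1)) ≤ (a + n) * (b + n) * (n + 1 + k) := by
        have h3 : 0 ≤ (a + b - c) * (n * (n + 1 + k)) :=
          mul_nonneg (by linarith) (by positivity)
        have : 0 ≤ k * (a * b) := by positivity
        nlinarith [mul_nonneg hn (sub_nonneg.mpr hk1)]
      calc _ = hypCoeff a b c n * ((n + k) * ((c + n) * (n + 1))) := by ring
        _ ≤ hypCoeff a b c n * ((a + n) * (b + n) * (n + 1 + k)) := by gcongr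
        _ = _ := by
          push_cast
          linear_combination (-((n : ℝ) + 1 + k)) * hrec
  intro hs
  have h4 : Summable fun n : ℕ => 1 / |(n : ℝ) + k| ^ (1 : ℝ) := by
    refine Summable.of_nonneg_of_le (fun n => by positivity) (fun n => ?_) (hs.mul_left k⁻¹)
    have hn : (0 : ℝ) < n + k := by positivity
    rw [Real.rpow_one, abs_of_pos hn, div_le_iff₀ hn, mul_assoc, ← div_eq_inv_mul, le_div_iff₀ hk,
      one_mul]
    exact key n
  exact absurd ((Real.summable_one_div_nat_add_rpow k 1).mp h4) (lt_irrefl _)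

theorem tendsto_hypF_atTop {a b c : ℝ} (ha : 0 < a) (hb : 0 < b) (hac : a < c)
    (h : c ≤ a + b) : Tendsto (hypF a b c) (nhdsWithin 1 (Iio 1)) atTop := by
  have hc := ha.trans hac
  have hdiv := (not_summable_iff_tendsto_nat_atTop_of_nonneg
    fun n => (hypCoeff_pos ha hb hc n).le).mp (not_summable_hypCoeff ha hb hc h)
  refine tendsto_atTop.mpr fun M => ?_
  obtain ⟨N, hN⟩ := (hdiv.eventually_gt_atTop M).exists
  have hcont : Continuous fun x : ℝ => ∑ n ∈ Finset.range N, hypCoeff a b c n * x ^ n := by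
    fun_prop
  have h1 : ∀ᶠ x in nhdsWithin (1 : ℝ) (Iio 1),
      M < ∑ n ∈ Finset.range N, hypCoeff a b c n * x ^ n :=
    (hcont.continuousAt.eventually_const_lt (by simpa using hN)).filter_mono nhdsWithin_le_nhds
  filter_upwards [h1, Ioo_mem_nhdsLT (one_pos : (0 : ℝ) < 1)] with x hx hx01
  refine hx.le.trans ?_
  refine (summable_hypCoeff_mul_pow ha hb hac
    (by rw [abs_of_pos hx01.1]; exact hx01.2)).sum_le_tsum _ fun n _ => ?_
  have := hypCoeff_pos ha hb hc n
  have := hx01.1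
  positivity

section

open MeasureTheory

theorem ofReal_beta_integrand (u v : ℝ) {x : ℝ} (hx : x ∈ Ioo (0 : ℝ) 1) :
    (x : ℂ) ^ ((u : ℂ) - 1) * (1 - (x : ℂ)) ^ ((v : ℂ) - 1) =
      ((x ^ (u - 1) * (1 - x) ^ (v - 1) : ℝ) : ℂ) := by
  rw [Complex.ofReal_mul, Complex.ofReal_cpow hx.1.le, Complex.ofReal_cpow (sub_nonneg.mpr hx.2.le)]
  push_cast
  rfl

theorem integrableOn_beta_integrand {u v : ℝ} (hu : 0 < u) (hv : 0 < v) :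
    IntegrableOn (fun x : ℝ => x ^ (u - 1) * (1 - x) ^ (v - 1)) (Ioo 0 1) := by
  have h := Complex.betaIntegral_convergent (u := u) (v := v) (by simpa) (by simpa)
  rw [intervalIntegrable_iff_integrableOn_Ioo_of_le zero_le_one] at h
  refine h.re.congr ((ae_restrict_iff' measurableSet_Ioo).mpr (ae_of_all _ fun x hx => ?_))
  simp only [ofReal_beta_integrand u v hx]
  exact Complex.ofReal_re _

theorem integral_beta_integrand {u v : ℝ} (hu : 0 < u) (hv : 0 < v) :
    ∫ x in Ioo (0 : ℝ) 1, x ^ (u - 1) * (1 - x) ^ (v - 1) =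
      Real.Gamma u * Real.Gamma v / Real.Gamma (u + v) := by
  have h := ProbabilityTheory.beta_eq_betaIntegralReal u v hu hv
  rw [ProbabilityTheory.beta, Complex.betaIntegral,
    intervalIntegral.integral_of_le zero_le_one, integral_Ioc_eq_integral_Ioo,
    setIntegral_congr_fun measurableSet_Ioo fun x hx => ofReal_beta_integrand u v hx,
    integral_complex_ofReal, Complex.ofReal_re] at h
  exact h.symm

/-- The integrand of Euler's integral representation of the hypergeometric function. -/
noncomputable def eulerIntegrand (a b c t u : ℝ) : ℝ :=
  u ^ (b - 1) * (1 - u) ^ (c - b - 1) * (1 - t * u) ^ (-a)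

theorem integrableOn_eulerIntegrand {a b c t : ℝ} (hb : 0 < b) (hbc : b < c) (ht0 : 0 ≤ t)
    (ht1 : t < 1) : IntegrableOn (eulerIntegrand a b c t) (Ioo 0 1) := by
  have hcont : ContinuousOn (fun u : ℝ => (1 - t * u) ^ (-a)) (Icc 0 1) := by
    refine ContinuousOn.rpow_const (by fun_prop) fun u hu => Or.inl ?_
    nlinarith [hu.1, hu.2]
  have h := integrableOn_beta_integrand hb (sub_pos.mpr hbc)
  rw [← integrableOn_Icc_iff_integrableOn_Ioo] at h ⊢
  exact h.mul_continuousOn hcont isCompact_Icc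

theorem hasSum_eulerIntegral {a b c t : ℝ} (ha : 0 < a) (hb : 0 < b) (hbc : b < c)
    (ht0 : 0 ≤ t) (ht1 : t ≤ 1) (hint : IntegrableOn (eulerIntegrand a b c t) (Ioo 0 1)) :
    HasSum (fun n => hypCoeff a b c n * t ^ n) (Real.Gamma c /
      (Real.Gamma b * Real.Gamma (c - b)) * ∫ u in Ioo (0 : ℝ) 1, eulerIntegrand a b c t u) := by
  have hc := hb.trans hbc
  let F : ℕ → ℝ → ℝ := fun n u =>
    shiftedFact a n / n.factorial * t ^ n * (u ^ (b + n - 1) * (1 - u) ^ (c - b - 1))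
  have hF0 : ∀ n, ∀ u ∈ Ioo (0 : ℝ) 1, 0 ≤ F n u := by
    intro n u hu
    have := shiftedFact_pos ha n
    have hu0 := hu.1
    have hu1 := sub_pos.mpr hu.2
    positivity
  have hF : ∀ u ∈ Ioo (0 : ℝ) 1, HasSum (fun n => F n u) (eulerIntegrand a b c t u) := by
    intro u hu
    have htu : |t * u| < 1 := by
      rw [abs_of_nonneg (mul_nonneg ht0 hu.1.le)]
      nlinarith [hu.1, hu.2]
    refine ((hasSum_shiftedFact_div_factorial_mul_pow a htu).mul_left
      (u ^ (b - 1) * (1 - u) ^ (c - b - 1))).congr_fun fun n => ?_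
    simp only [F]
    rw [add_sub_right_comm, Real.rpow_add hu.1, Real.rpow_natCast, mul_pow]
    ring
  have hFint : ∀ n : ℕ, ∫ u in Ioo (0 : ℝ) 1, F n u = shiftedFact a n / n.factorial * t ^ n *
      (Real.Gamma (b + n) * Real.Gamma (c - b) / Real.Gamma (c + n)) := by
    intro n
    rw [integral_const_mul, integral_beta_integrand (by positivity) (sub_pos.mpr hbc)]
    congr 3
    ring
  have hae : ∀ {p : ℝ → Prop}, (∀ u ∈ Ioo (0 : ℝ) 1, p u) →
      ∀ᵐ u ∂(volume.restrict (Ioo (0 : ℝ) 1)), p u := fun h =>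
    (ae_restrict_iff' measurableSet_Ioo).mpr (ae_of_all _ h)
  have key := hasSum_integral_of_dominated_convergence (μ := volume.restrict (Ioo (0 : ℝ) 1))
    (F := F) (f := eulerIntegrand a b c t) F
    (fun n => ((integrableOn_beta_integrand (by positivity : 0 < b + n)
      (sub_pos.mpr hbc)).const_mul _).aestronglyMeasurable)
    (fun n => hae fun u hu => (Real.norm_of_nonneg (hF0 n u hu)).le)
    (hae fun u hu => (hF u hu).summable)
    (hint.congr (hae fun u hu => (hF u hu).tsum_eq.symm)) (hae hF)
  convert! key.mul_left (Real.Gamma c / (Real.Gamma b * Real.Gamma (c - b))) using 2 with n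
  have := Real.Gamma_pos_of_pos hb
  have := Real.Gamma_pos_of_pos hc
  have := Real.Gamma_pos_of_pos (sub_pos.mpr hbc)
  have := shiftedFact_pos hc n
  rw [hFint, Gamma_add_natCast hb, Gamma_add_natCast hc, hypCoeff]
  field_simp

/-- **Gauss's summation theorem**. -/
theorem hasSum_hypCoeff {a b c : ℝ} (ha : 0 < a) (hb : 0 < b) (h : a + b < c) :
    HasSum (hypCoeff a b c) (Real.Gamma c * Real.Gamma (c - a - b) /
      (Real.Gamma (c - a) * Real.Gamma (c - b))) := by
  have hcab : 0 < c - a - b := by linarith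
  have hcb : 0 < c - b := by linarith
  have hI : EqOn (eulerIntegrand a b c 1) (fun u => u ^ (b - 1) * (1 - u) ^ (c - a - b - 1))
      (Ioo 0 1) := by
    intro u hu
    simp only [eulerIntegrand]
    rw [one_mul, mul_assoc, ← Real.rpow_add (sub_pos.mpr hu.2)]
    congr 2
    ring
  have hs := hasSum_eulerIntegral ha hb (by linarith : b < c) zero_le_one le_rfl
    ((integrableOn_beta_integrand hb hcab).congr_fun hI.symm measurableSet_Ioo)
  rw [setIntegral_congr_fun measurableSet_Ioo hI, integral_beta_integrand hb hcab] at hs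
  convert! hs using 1
  · simp
  · have := Real.Gamma_pos_of_pos hb
    have := Real.Gamma_pos_of_pos hcb
    rw [show b + (c - a - b) = c - a by ring]
    field_simp

theorem one_sub_one_sub_div {t v : ℝ} (h : 1 - t * v ≠ 0) :
    1 - (1 - v) / (1 - t * v) = v * (1 - t) / (1 - t * v) := by
  rw [eq_div_iff h, sub_mul, div_mul_cancel₀ _ h]
  ring

theorem one_sub_mul_one_sub_div {t v : ℝ} (h : 1 - t * v ≠ 0) :
    1 - t * ((1 - v) / (1 - t * v)) = (1 - t) / (1 - t * v) := by
  rw [eq_div_iff h, sub_mul, mul_assoc, div_mul_cancel₀ _ h]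
  ring

theorem image_one_sub_div_one_sub_mul {t : ℝ} (ht0 : 0 ≤ t) (ht1 : t < 1) :
    (fun v : ℝ => (1 - v) / (1 - t * v)) '' Ioo 0 1 = Ioo 0 1 := by
  have hpos : ∀ v ∈ Ioo (0 : ℝ) 1, 0 < 1 - t * v := fun v hv => by nlinarith [hv.1, hv.2]
  have hmaps : ∀ v ∈ Ioo (0 : ℝ) 1, (1 - v) / (1 - t * v) ∈ Ioo (0 : ℝ) 1 := by
    intro v hv
    have := hpos v hv
    refine ⟨div_pos (sub_pos.mpr hv.2) this, (div_lt_one this).mpr ?_⟩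
    nlinarith [hv.1, hv.2]
  refine Subset.antisymm (image_subset_iff.mpr hmaps) fun v hv => ⟨_, hmaps v hv, ?_⟩
  have h1 := (hpos v hv).ne'
  have h2 : 1 - t ≠ 0 := by linarith
  simp only [one_sub_one_sub_div h1, one_sub_mul_one_sub_div h1]
  rw [div_div_div_cancel_right₀ h1, mul_div_cancel_right₀ _ h2]

/-- The effect of the involution `v ↦ (1 - v) / (1 - t * v)` on Euler's integral. -/
theorem integral_eulerIntegrand_eq {a b c t : ℝ} (ht0 : 0 ≤ t) (ht1 : t < 1) :
    ∫ u in Ioo (0 : ℝ) 1, eulerIntegrand a b c t u =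
      (1 - t) ^ (c - a - b) * ∫ v in Ioo (0 : ℝ) 1, eulerIntegrand (c - a) (c - b) c t v := by
  have hpos : ∀ v ∈ Ioo (0 : ℝ) 1, 0 < 1 - t * v := fun v hv => by nlinarith [hv.1, hv.2]
  have ht : 0 < 1 - t := sub_pos.mpr ht1
  have hderiv : ∀ v ∈ Ioo (0 : ℝ) 1, HasDerivWithinAt (fun v : ℝ => (1 - v) / (1 - t * v))
      (-((1 - t) / (1 - t * v) ^ 2)) (Ioo 0 1) v := by
    intro v hv
    have h1 := (((hasDerivAt_id v).const_sub 1).div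
      (((hasDerivAt_id v).const_mul t).const_sub 1) (hpos v hv).ne').hasDerivWithinAt (s := Ioo 0 1)
    refine h1.congr_deriv ?_
    simp only [id]
    ring
  have hinj : InjOn (fun v : ℝ => (1 - v) / (1 - t * v)) (Ioo 0 1) := by
    intro v hv w hw h
    rw [div_eq_div_iff (hpos v hv).ne' (hpos w hw).ne'] at h
    refine mul_left_cancel₀ ht.ne' ?_
    linarith
  conv_lhs => rw [← image_one_sub_div_one_sub_mul ht0 ht1]
  rw [integral_image_eq_integral_abs_deriv_smul measurableSet_Ioo hderiv hinj,
    ← integral_const_mul]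
  refine setIntegral_congr_fun measurableSet_Ioo fun v hv => ?_
  have hd := hpos v hv
  have hv0 := hv.1
  have hv1 : 0 < 1 - v := sub_pos.mpr hv.2
  simp only [eulerIntegrand, smul_eq_mul]
  rw [one_sub_one_sub_div hd.ne', one_sub_mul_one_sub_div hd.ne', abs_neg,
    abs_of_pos (by positivity), Real.div_rpow hv1.le hd.le,
    Real.div_rpow (by positivity) hd.le, Real.mul_rpow hv0.le ht.le, Real.div_rpow ht.le hd.le]
  have p1 : (1 - t) ^ (c - a - b) = (1 - t) * (1 - t) ^ (c - b - 1) * (1 - t) ^ (-a) := by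
    rw [show c - a - b = 1 + (c - b - 1) + -a by ring, Real.rpow_add ht, Real.rpow_add ht,
      Real.rpow_one]
  have p2 : (1 - t * v) ^ (-(c - a)) = ((1 - t * v) ^ 2 * (1 - t * v) ^ (b - 1) *
      (1 - t * v) ^ (c - b - 1) * (1 - t * v) ^ (-a))⁻¹ := by
    rw [Real.rpow_neg hd.le, show c - a = 2 + (b - 1) + (c - b - 1) + -a by ring,
      Real.rpow_add hd, Real.rpow_add hd, Real.rpow_add hd, Real.rpow_two]
  rw [p1, p2, sub_sub_cancel]
  simp only [mul_inv]
  ring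

/-- **Euler's transformation** of the hypergeometric function. -/
theorem hypF_eq_one_sub_rpow_mul_hypF {a b c t : ℝ} (ha : 0 < a) (hb : 0 < b) (hac : a < c)
    (hbc : b < c) (ht0 : 0 ≤ t) (ht1 : t < 1) :
    hypF a b c t = (1 - t) ^ (c - a - b) * hypF (c - a) (c - b) c t := by
  have hca : 0 < c - a := sub_pos.mpr hac
  have hcb : 0 < c - b := sub_pos.mpr hbc
  have hcbc : c - b < c := sub_lt_self c hb
  have h1 := (hasSum_eulerIntegral ha hb hbc ht0 ht1.le
    (integrableOn_eulerIntegrand hb hbc ht0 ht1)).tsum_eq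
  have h2 := (hasSum_eulerIntegral hca hcb hcbc ht0 ht1.le
    (integrableOn_eulerIntegrand hcb hcbc ht0 ht1)).tsum_eq
  rw [← hypF_eq_tsum] at h1 h2
  rw [h1, h2, integral_eulerIntegrand_eq ht0 ht1, sub_sub_cancel]
  ring

end

theorem one_sub_exp_neg_mem_Ico {x : ℝ} (hx : 0 ≤ x) : 1 - Real.exp (-x) ∈ Ico (0 : ℝ) 1 :=
  ⟨by simpa using hx, by simpa using Real.exp_pos (-x)⟩

theorem monotone_one_sub_exp_neg : Monotone fun x : ℝ => 1 - Real.exp (-x) := fun _ _ h =>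
  sub_le_sub_left (Real.exp_le_exp.mpr (neg_le_neg h)) 1

theorem tendsto_one_sub_exp_neg_atTop :
    Tendsto (fun x : ℝ => 1 - Real.exp (-x)) atTop (nhdsWithin 1 (Iio 1)) := by
  refine tendsto_nhdsWithin_iff.mpr ⟨?_, Eventually.of_forall fun x => ?_⟩
  · simpa using Real.tendsto_exp_neg_atTop_nhds_zero.const_sub 1
  · simpa using Real.exp_pos (-x)

theorem hypF_one_sub_exp_neg_monotoneOn {a b c : ℝ} (ha : 0 < a) (hb : 0 < b) (hac : a < c) :
    MonotoneOn (fun x => hypF a b c (1 - Real.exp (-x))) (Ici 0) :=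
  (hypF_monotoneOn ha hb hac).comp (monotone_one_sub_exp_neg.monotoneOn _)
    fun _ hx => one_sub_exp_neg_mem_Ico hx

theorem hypF_one_sub_exp_neg {a b c x : ℝ} (ha : 0 < a) (hb : 0 < b) (hac : a < c) (hbc : b < c)
    (hx : 0 ≤ x) : hypF a b c (1 - Real.exp (-x)) =
      Real.exp ((a + b - c) * x) * hypF (c - a) (c - b) c (1 - Real.exp (-x)) := by
  obtain ⟨h0, h1⟩ := one_sub_exp_neg_mem_Ico hx
  rw [hypF_eq_one_sub_rpow_mul_hypF ha hb hac hbc h0 h1, sub_sub_cancel, ← Real.exp_mul]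
  congr 2
  ring

theorem stmt3 (a b c : ℝ) (ha : 0 < a) (hb : 0 < b) (hac : a < c) (hbc : b < c)
    (f g h : ℝ → ℝ)
    (hf : ∀ x, f x = hypF a b c (1 - Real.exp (-x)))
    (hg : ∀ x, g x = f x * Real.exp (-(a + b - c) * x))
    (hh : ∀ x, h x = deriv f x * Real.exp (-(a + b - c) * x)) :
    MonotoneOn f (Set.Ici 0) ∧ MonotoneOn g (Set.Ici 0) ∧ MonotoneOn h (Set.Ici 0) ∧
    f 0 = 1 ∧ g 0 = 1 ∧ h 0 = a * b / c ∧
    (a + b > c → Tendsto f atTop atTop) ∧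
    (a + b = c → Tendsto f atTop atTop ∧ Tendsto g atTop atTop) ∧
    (a + b < c →
      Tendsto f atTop (nhds (betaR c (c - a - b) / betaR (c - a) (c - b))) ∧
      Tendsto g atTop atTop) ∧
    (a + b + 1 > c → Tendsto h atTop
      (nhds (Real.Gamma c * Real.Gamma (a + b + 1 - c) / (Real.Gamma a * Real.Gamma b)))) ∧
    (a + b + 1 ≤ c → Tendsto h atTop atTop) := by
  have hc := ha.trans hac
  have hca : 0 < c - a := sub_pos.mpr hac
  have hcb : 0 < c - b := sub_pos.mpr hbc
  obtain rfl : f = fun x => hypF a b c (1 - Real.exp (-x)) := funext hf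
  have hgx : EqOn g (fun x => hypF (c - a) (c - b) c (1 - Real.exp (-x))) (Ici 0) := by
    intro x hx
    simp only [hg]
    rw [hypF_one_sub_exp_neg ha hb hac hbc hx, mul_right_comm, ← Real.exp_add, neg_mul,
      add_neg_cancel, Real.exp_zero, one_mul]
  have hderiv : ∀ x, 0 ≤ x → deriv (fun x => hypF a b c (1 - Real.exp (-x))) x =
      a * b / c * hypF (a + 1) (b + 1) (c + 1) (1 - Real.exp (-x)) * Real.exp (-x) := by
    intro x hx
    obtain ⟨h0, h1⟩ := one_sub_exp_neg_mem_Ico hx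
    have he : HasDerivAt (fun x : ℝ => 1 - Real.exp (-x)) (Real.exp (-x)) x := by
      simpa using ((hasDerivAt_neg x).exp).const_sub 1
    exact ((hasDerivAt_hypF ha hb hac (by rwa [abs_of_nonneg h0])).comp x he).deriv
  have hhx : EqOn h (fun x => a * b / c * hypF (c - a) (c - b) (c + 1) (1 - Real.exp (-x)))
      (Ici 0) := by
    intro x hx
    simp only [hh]
    rw [hderiv x hx, hypF_one_sub_exp_neg (by linarith) (by linarith) (by linarith)
      (by linarith) hx, add_sub_add_right_eq_sub, add_sub_add_right_eq_sub]
    have he : Real.exp ((a + 1 + (b + 1) - (c + 1)) * x) * Real.exp (-x) *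
        Real.exp (-(a + b - c) * x) = 1 := by
      rw [← Real.exp_add, ← Real.exp_add, Real.exp_eq_one_iff]
      ring
    linear_combination a * b / c * hypF (c - a) (c - b) (c + 1) (1 - Real.exp (-x)) * he
  have hgev := (hgx.eventuallyEq_of_mem (Ici_mem_atTop 0)).symm
  have hhev := (hhx.eventuallyEq_of_mem (Ici_mem_atTop 0)).symm
  have hab : 0 < a * b / c := by positivity
  have hf_top : c ≤ a + b → Tendsto (fun x => hypF a b c (1 - Real.exp (-x))) atTop atTop :=
    fun hle => (tendsto_hypF_atTop ha hb hac hle).comp tendsto_one_sub_exp_neg_atTop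
  have hg_top : a + b ≤ c → Tendsto g atTop atTop := fun hle =>
    ((tendsto_hypF_atTop hca hcb (by linarith) (by linarith)).comp
      tendsto_one_sub_exp_neg_atTop).congr' hgev
  refine ⟨hypF_one_sub_exp_neg_monotoneOn ha hb hac,
    (hypF_one_sub_exp_neg_monotoneOn hca hcb (by linarith)).congr hgx.symm,
    MonotoneOn.congr (fun x hx y hy hxy => mul_le_mul_of_nonneg_left
      (hypF_one_sub_exp_neg_monotoneOn hca hcb (by linarith) hx hy hxy) hab.le) hhx.symm,
    by simp [hypF_zero], by simp [hg, hypF_zero], ?_, fun hlt => hf_top hlt.le,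
    fun heq => ⟨hf_top heq.ge, hg_top heq.le⟩, fun hlt => ⟨?_, hg_top hlt.le⟩, fun hlt => ?_,
    fun hle => ?_⟩
  · rw [hhx self_mem_Ici]
    simp [hypF_zero]
  · have hs := hasSum_hypCoeff ha hb hlt
    have hlim := tendsto_hypF_of_summable ha hb hc hs.summable
    rw [hs.tsum_eq] at hlim
    convert! hlim.comp tendsto_one_sub_exp_neg_atTop using 2
    have := Real.Gamma_pos_of_pos hca
    have := Real.Gamma_pos_of_pos hcb
    have := Real.Gamma_pos_of_pos (show 0 < c - a + (c - b) by linarith)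
    rw [betaR, betaR, show c + (c - a - b) = c - a + (c - b) by ring]
    field_simp
  · have hs := hasSum_hypCoeff hca hcb (show c - a + (c - b) < c + 1 by linarith)
    have hlim := tendsto_hypF_of_summable hca hcb (by linarith) hs.summable
    rw [hs.tsum_eq] at hlim
    have hlim' := (hlim.comp tendsto_one_sub_exp_neg_atTop).const_mul (a * b / c)
    refine Tendsto.congr' hhev ?_
    convert! hlim' using 2
    have := Real.Gamma_pos_of_pos ha
    have := Real.Gamma_pos_of_pos hb
    rw [show c + 1 - (c - a) - (c - b) = a + b + 1 - c by ring,
      show c + 1 - (c - a) = a + 1 by ring, show c + 1 - (c - b) = b + 1 by ring,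
      Real.Gamma_add_one ha.ne', Real.Gamma_add_one hb.ne', Real.Gamma_add_one hc.ne']
    field_simp
  · exact (((tendsto_hypF_atTop hca hcb (by linarith) (by linarith)).comp
      tendsto_one_sub_exp_neg_atTop).const_mul_atTop hab).congr' hhev
end

section
/- Let a, b, c > 0. Then for all x ∈ (0,1), the function M satisfies M(a,b,c,x) = M(a,b,c,1−x) and M(a,b,c,x) > 0. -/
open Filter Set

/-- `M(a,b,c,x) = x(1−x)(v₁(x)v'(x) − v(x)v₁'(x))` with `v(x)=F(a,b;c;x)`, `v₁(x)=F(a,b;c;1−x)`. -/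
noncomputable def Mfun (a b c x : ℝ) : ℝ :=
  x * (1 - x) * (hypF a b c (1 - x) * deriv (fun t => hypF a b c t) x
    - hypF a b c x * deriv (fun t => hypF a b c (1 - t)) x)

theorem ordinaryHypergeometricSeries_apply_eq_hypCoeff (a b c x : ℝ) (n : ℕ) :
    (ordinaryHypergeometricSeries ℝ a b c n fun _ => x) = hypCoeff a b c n * x ^ n := by
  rw [ordinaryHypergeometricSeries_apply_eq, hypCoeff, smul_eq_mul]
  simp only [shiftedFact_eq_eval_ascPochhammer, div_eq_mul_inv, mul_inv]
  ring

theorem hypF_hasFPowerSeriesOnBall {a b c : ℝ} (ha : 0 < a) (hb : 0 < b) (hc : 0 < c) :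
    HasFPowerSeriesOnBall (hypF a b c) (ordinaryHypergeometricSeries ℝ a b c) 0 1 := by
  have hr := ordinaryHypergeometricSeries_radius_eq_one ℝ a b c fun k => by
    have : (0 : ℝ) ≤ k := k.cast_nonneg
    exact ⟨by linarith, by linarith, by linarith⟩
  have h := (ordinaryHypergeometricSeries ℝ a b c).hasFPowerSeriesOnBall (by simp [hr])
  rw [hr] at h
  convert! h using 1
  ext x
  exact tsum_congr fun n => (ordinaryHypergeometricSeries_apply_eq_hypCoeff a b c x n).symm

theorem hasSum_hypF {a b c x : ℝ} (ha : 0 < a) (hb : 0 < b) (hc : 0 < c) (hx : x ∈ Ioo (0 : ℝ) 1) :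
    HasSum (fun n => hypCoeff a b c n * x ^ n) (hypF a b c x) := by
  have h := (hypF_hasFPowerSeriesOnBall ha hb hc).hasSum (y := x) (by
    simp [enorm_eq_nnnorm, ← NNReal.coe_lt_coe, abs_of_pos hx.1, hx.2])
  simpa only [zero_add, ordinaryHypergeometricSeries_apply_eq_hypCoeff] using h

theorem hypF_pos {a b c x : ℝ} (ha : 0 < a) (hb : 0 < b) (hc : 0 < c) (hx : x ∈ Ioo (0 : ℝ) 1) :
    0 < hypF a b c x := by
  have h := le_hasSum (hasSum_hypF ha hb hc hx) 0 fun n _ =>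
    mul_nonneg (hypCoeff_pos ha hb hc n).le (pow_nonneg hx.1.le n)
  exact lt_of_lt_of_le (mul_pos (hypCoeff_pos ha hb hc 0) (pow_pos hx.1 0)) h

theorem differentiableAt_hypF {a b c x : ℝ} (ha : 0 < a) (hb : 0 < b) (hc : 0 < c)
    (hx : x ∈ Ioo (0 : ℝ) 1) : DifferentiableAt ℝ (hypF a b c) x :=
  ((hypF_hasFPowerSeriesOnBall ha hb hc).analyticAt_of_mem (by
    simp [enorm_eq_nnnorm, ← NNReal.coe_lt_coe, abs_of_pos hx.1, hx.2])).differentiableAt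

/-- Since all coefficients are positive, subtracting the linear term leaves a monotone function. -/
theorem monotoneOn_hypF_sub_linear {a b c : ℝ} (ha : 0 < a) (hb : 0 < b) (hc : 0 < c) :
    MonotoneOn (fun x => hypF a b c x - hypCoeff a b c 1 * x) (Ioo 0 1) := by
  intro x hx y hy hxy
  have h := le_hasSum ((hasSum_hypF ha hb hc hy).sub (hasSum_hypF ha hb hc hx)) 1 fun n _ =>
    sub_nonneg.2 <| mul_le_mul_of_nonneg_left (pow_le_pow_left₀ hx.1.le hxy n)
      (hypCoeff_pos ha hb hc n).le
  simp only [pow_one] at h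
  dsimp only
  linarith

theorem deriv_hypF_pos {a b c x : ℝ} (ha : 0 < a) (hb : 0 < b) (hc : 0 < c)
    (hx : x ∈ Ioo (0 : ℝ) 1) : 0 < deriv (hypF a b c) x := by
  have h := (monotoneOn_hypF_sub_linear ha hb hc).derivWithin_nonneg (x := x)
  have hd := (differentiableAt_hypF ha hb hc hx).hasDerivAt.fun_sub
    ((hasDerivAt_id' x).const_mul (hypCoeff a b c 1))
  rw [derivWithin_of_isOpen isOpen_Ioo hx, hd.deriv, mul_one] at h
  linarith [hypCoeff_pos ha hb hc 1]

theorem Mfun_eq (a b c x : ℝ) :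
    Mfun a b c x = x * (1 - x) * (hypF a b c (1 - x) * deriv (hypF a b c) x
      + hypF a b c x * deriv (hypF a b c) (1 - x)) := by
  rw [Mfun, deriv_comp_const_sub]
  ring

theorem stmt5 (a b c : ℝ) (ha : 0 < a) (hb : 0 < b) (hc : 0 < c) :
    ∀ x ∈ Set.Ioo (0 : ℝ) 1, Mfun a b c x = Mfun a b c (1 - x) ∧ 0 < Mfun a b c x := by
  intro x hx
  have hx' : 1 - x ∈ Ioo (0 : ℝ) 1 := ⟨by linarith [hx.2], by linarith [hx.1]⟩
  refine ⟨?_, ?_⟩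
  · rw [Mfun_eq, Mfun_eq, sub_sub_cancel]
    ring
  · rw [Mfun_eq]
    exact mul_pos (mul_pos hx.1 hx'.1) <| add_pos
      (mul_pos (hypF_pos ha hb hc hx') (deriv_hypF_pos ha hb hc hx))
      (mul_pos (hypF_pos ha hb hc hx) (deriv_hypF_pos ha hb hc hx'))
end
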